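/- (Helly's Selection Principle in a reflexive Banach space.) Let E be a reflexive Banach space over ℝ, let τ > 0, and let S^N : [0, τ] → E (N ∈ ℕ) be a sequence of maps for which there is a constant C > 0 with ‖S^N(t)‖_E ≤ C for all t ∈ [0, τ] and all N, and Var(S^N; [0, τ]) ≤ C for all N, where Var(S; [0, τ]) := sup over finite partitions 0 = t_0 < t_1 < ⋯ < t_K = τ of Σ_{k=0}^{K−1} ‖S(t_{k+1}) − S(t_k)‖_E. Then there exist a strictly increasing sequence of indices N_i and a map S : [0, τ] → E with Var(S; [0, τ]) ≤ C such that for every t ∈ [0, τ], S^{N_i}(t) converges weakly to S(t) in E, i.e. ℓ(S^{N_i}(t)) → ℓ(S(t)) for every continuous linear functional ℓ on E. -/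

import Mathlib

open Filter Topology

/-- A sequence of real families over a countable index set that is bounded at each index
has a subsequence converging at every index. -/
theorem exists_subseq_forall_tendsto {ι : Type*} [Countable ι] (a : ℕ → ι → ℝ) (R : ι → ℝ)
    (h : ∀ n i, |a n i| ≤ R i) :
    ∃ φ : ℕ → ℕ, StrictMono φ ∧ ∃ b : ι → ℝ, ∀ i, Tendsto (fun n => a (φ n) i) atTop (𝓝 (b i)) := by
  have hc : IsCompact (Set.univ.pi fun i => Set.Icc (-R i) (R i)) :=
    isCompact_univ_pi fun i => isCompact_Icc
  obtain ⟨b, -, φ, hφ, hb⟩ := hc.tendsto_subseq (x := a) fun n i _ => abs_le.mp (h n i)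
  exact ⟨φ, hφ, b, tendsto_pi_nhds.mp hb⟩

/-- A bounded real function converges along every ultrafilter. -/
theorem Ultrafilter.exists_tendsto_of_abs_le {α : Type*} (U : Ultrafilter α) (a : α → ℝ) (R : ℝ)
    (h : ∀ n, |a n| ≤ R) : ∃ b, Tendsto a U (𝓝 b) := by
  obtain ⟨b, -, hb⟩ := (isCompact_Icc (a := -R) (b := R)).ultrafilter_le_nhds (U.map a) (by
    rw [le_principal_iff]
    exact mem_map.mpr (univ_mem' fun n => abs_le.mp (h n)))
  exact ⟨b, hb⟩

/-- A function of bounded variation is controlled by the increments of its variation. -/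
theorem norm_sub_le_toReal_eVariationOn_sub {E : Type*} [SeminormedAddCommGroup E]
    {g : ℝ → E} (hg : eVariationOn g Set.univ ≠ ⊤)
    {s t : ℝ} (hst : s ≤ t) :
    ‖g t - g s‖ ≤
      (eVariationOn g (Set.Iic t)).toReal - (eVariationOn g (Set.Iic s)).toReal := by
  have fin (r : Set ℝ) : eVariationOn g r ≠ ⊤ :=
    ne_top_of_le_ne_top hg (eVariationOn.mono g (Set.subset_univ r))
  have h1 : eVariationOn g (Set.Iic s) + edist (g t) (g s) ≤ eVariationOn g (Set.Iic t) :=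
    calc _ ≤ eVariationOn g (Set.Iic s) + eVariationOn g (Set.Icc s t) := by
          gcongr
          exact eVariationOn.edist_le g ⟨hst, le_rfl⟩ ⟨le_rfl, hst⟩
      _ ≤ eVariationOn g (Set.Iic s ∪ Set.Icc s t) :=
          eVariationOn.add_le_union g fun a ha b hb => le_trans ha hb.1
      _ ≤ _ := eVariationOn.mono g
          (Set.union_subset (Set.Iic_subset_Iic.mpr hst) fun b hb => hb.2)
  have h2 := ENNReal.toReal_mono (fin _) h1
  rw [ENNReal.toReal_add (fin _) (edist_ne_top _ _), ← dist_edist, dist_eq_norm] at h2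
  linarith

section Reflexive

variable {E : Type*} [NormedAddCommGroup E] [NormedSpace ℝ E]

theorem abs_dual_apply_le {x : E} {C : ℝ} (hx : ‖x‖ ≤ C) (l : E →L[ℝ] ℝ) : |l x| ≤ ‖l‖ * C :=
  (l.le_opNorm x).trans (mul_le_mul_of_nonneg_left hx (norm_nonneg l))

/-- In a reflexive space, a bounded function all of whose scalar images converge
has a weak limit. -/
theorem exists_weak_limit_of_forall_tendsto
    (hrefl : Function.Surjective ⇑(NormedSpace.inclusionInDoubleDual ℝ E))
    {α : Type*} {F : Filter α} [F.NeBot] {x : α → E} {C : ℝ} (hx : ∀ n, ‖x n‖ ≤ C)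
    (h : ∀ l : E →L[ℝ] ℝ, ∃ b, Tendsto (fun n => l (x n)) F (𝓝 b)) :
    ∃ y : E, ∀ l : E →L[ℝ] ℝ, Tendsto (fun n => l (x n)) F (𝓝 (l y)) := by
  choose b hb using h
  let L : (E →L[ℝ] ℝ) →ₗ[ℝ] ℝ :=
    { toFun := b
      map_add' := fun l m => tendsto_nhds_unique (hb (l + m)) ((hb l).add (hb m))
      map_smul' := fun c l => tendsto_nhds_unique (hb (c • l)) ((hb l).const_mul c) }
  have hL : ∀ l, ‖L l‖ ≤ C * ‖l‖ := fun l =>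
    le_of_tendsto (hb l).norm (Eventually.of_forall fun n => by
      rw [mul_comm]; exact abs_dual_apply_le (hx n) l)
  obtain ⟨y, hy⟩ := hrefl (L.mkContinuous C hL)
  refine ⟨y, fun l => ?_⟩
  have : l y = b l := by
    rw [← NormedSpace.dual_def ℝ E y l, hy]; rfl
  rw [this]
  exact hb l

/-- A separable set admits a sequence of continuous functionals separating its points
from zero. -/
theorem exists_seq_dual_separating {s : Set E} (hs : TopologicalSpace.IsSeparable s) :
    ∃ f : ℕ → E →L[ℝ] ℝ, ∀ y ∈ s, (∀ n, f n y = 0) → y = 0 := by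
  rcases s.eq_empty_or_nonempty with rfl | hne
  · exact ⟨0, by simp⟩
  obtain ⟨c, hc, hsc⟩ := hs
  have hcne : c.Nonempty := by
    rw [← closure_nonempty_iff]; exact hne.mono hsc
  obtain ⟨u, rfl⟩ := hc.exists_eq_range hcne
  choose f hf hfu using fun n => exists_dual_vector'' ℝ (u n)
  refine ⟨f, fun y hy h0 => ?_⟩
  by_contra hne
  obtain ⟨_, ⟨n, rfl⟩, hn⟩ :=
    Metric.mem_closure_iff.mp (hsc hy) (‖y‖ / 2) (half_pos (norm_pos_iff.mpr hne))
  have h1 : ‖u n‖ ≤ ‖u n - y‖ := by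
    have h2 : f n (u n - y) = ‖u n‖ := by
      rw [map_sub, h0 n, sub_zero, hfu]; rfl
    have h3 := (f n).le_of_opNorm_le (hf n) (u n - y)
    rw [h2, norm_norm, one_mul] at h3
    exact h3
  rw [dist_eq_norm, norm_sub_rev] at hn
  have h4 : ‖y‖ ≤ ‖u n‖ + ‖u n - y‖ := by
    simpa using norm_sub_le (u n) (u n - y)
  linarith

/-- In a reflexive space, a bounded sequence in a closed subspace converges weakly once it
converges against a family of functionals separating the points of that subspace. -/
theorem exists_weak_limit_of_separating
    (hrefl : Function.Surjective ⇑(NormedSpace.inclusionInDoubleDual ℝ E))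
    {ι : Type*} {Y : Submodule ℝ E} (hY : IsClosed (Y : Set E)) {f : ι → E →L[ℝ] ℝ}
    (hf : ∀ y ∈ Y, (∀ i, f i y = 0) → y = 0)
    {x : ℕ → E} {C : ℝ} (hx : ∀ n, ‖x n‖ ≤ C) (hxY : ∀ n, x n ∈ Y)
    (h : ∀ i, ∃ b, Tendsto (fun n => f i (x n)) atTop (𝓝 b)) :
    ∃ y : E, ∀ l : E →L[ℝ] ℝ, Tendsto (fun n => l (x n)) atTop (𝓝 (l y)) := by
  have key (U : Ultrafilter ℕ) :
      ∃ y : E, ∀ l : E →L[ℝ] ℝ, Tendsto (fun n => l (x n)) U (𝓝 (l y)) :=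
    exists_weak_limit_of_forall_tendsto hrefl hx fun l =>
      U.exists_tendsto_of_abs_le _ _ fun n => abs_dual_apply_le (hx n) l
  have mem_of_limit (U : Ultrafilter ℕ) (y : E)
      (hy : ∀ l : E →L[ℝ] ℝ, Tendsto (fun n => l (x n)) U (𝓝 (l y))) : y ∈ Y := by
    by_contra hyY
    obtain ⟨l, u, hl, hlu⟩ := geometric_hahn_banach_closed_point Y.convex hY hyY
    exact absurd (le_of_tendsto (hy l) (Eventually.of_forall fun n => (hl _ (hxY n)).le))
      (not_le.mpr hlu)
  obtain ⟨y, hy⟩ := key (hyperfilter ℕ)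
  have hyperfilter_le : (hyperfilter ℕ : Filter ℕ) ≤ atTop := Nat.hyperfilter_le_atTop
  refine ⟨y, fun l => (tendsto_iff_ultrafilter _ _ _).mpr fun U hU => ?_⟩
  obtain ⟨z, hz⟩ := key U
  have hzy : z - y = 0 := by
    refine hf _ (Y.sub_mem (mem_of_limit U z hz) (mem_of_limit _ y hy)) fun i => ?_
    obtain ⟨b, hb⟩ := h i
    rw [map_sub, tendsto_nhds_unique (hz (f i)) (hb.mono_left hU),
      tendsto_nhds_unique (hy (f i)) (hb.mono_left hyperfilter_le), sub_self]
  rw [← sub_eq_zero.mp hzy]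
  exact hz l

/-- In a reflexive space, a sequence of bounded families over a countable index set has a
subsequence converging weakly at every index. -/
theorem exists_subseq_forall_weak_limit
    (hrefl : Function.Surjective ⇑(NormedSpace.inclusionInDoubleDual ℝ E))
    {ι : Type*} [Countable ι] {x : ℕ → ι → E} {C : ℝ} (hx : ∀ n i, ‖x n i‖ ≤ C) :
    ∃ φ : ℕ → ℕ, StrictMono φ ∧ ∀ i, ∃ y : E, ∀ l : E →L[ℝ] ℝ,
      Tendsto (fun n => l (x (φ n) i)) atTop (𝓝 (l y)) := by
  let A : Set E := Set.range fun p : ℕ × ι => x p.1 p.2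
  let Y : Submodule ℝ E := (Submodule.span ℝ A).topologicalClosure
  have hsep : TopologicalSpace.IsSeparable (Y : Set E) :=
    ((Set.countable_range _).isSeparable.span (R := ℝ)).closure
  obtain ⟨f, hf⟩ := exists_seq_dual_separating hsep
  obtain ⟨φ, hφ, b, hb⟩ := exists_subseq_forall_tendsto
    (fun n (p : ℕ × ι) => f p.1 (x n p.2)) (fun p => ‖f p.1‖ * C)
    fun n p => abs_dual_apply_le (hx n p.2) (f p.1)
  refine ⟨φ, hφ, fun i => exists_weak_limit_of_separating hrefl
    (Submodule.isClosed_topologicalClosure _) hf (fun n => hx (φ n) i)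
    (fun n => ?_) fun k => ⟨b (k, i), hb (k, i)⟩⟩
  exact Submodule.le_topologicalClosure _ (Submodule.subset_span ⟨(φ n, i), rfl⟩)

/-- The variation is sequentially lower semicontinuous for pointwise weak convergence. -/
theorem eVariationOn_le_of_tendsto_weak {α : Type*} [LinearOrder α] {s : Set α}
    {g : ℕ → α → E} {G : α → E} {C : ℝ} (hC : 0 ≤ C)
    (hvar : ∀ n, eVariationOn (g n) s ≤ ENNReal.ofReal C)
    (h : ∀ t ∈ s, ∀ l : E →L[ℝ] ℝ, Tendsto (fun n => l (g n t)) atTop (𝓝 (l (G t)))) :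
    eVariationOn G s ≤ ENNReal.ofReal C := by
  refine iSup_le fun ⟨m, u, hu, hus⟩ => ?_
  choose l hl hlG using fun i => exists_dual_vector'' ℝ (G (u (i + 1)) - G (u i))
  have sum_eq (k : α → E) : ∑ i ∈ Finset.range m, edist (k (u (i + 1))) (k (u i)) =
      ENNReal.ofReal (∑ i ∈ Finset.range m, ‖k (u (i + 1)) - k (u i)‖) := by
    rw [ENNReal.ofReal_sum_of_nonneg fun i _ => norm_nonneg _]
    simp only [edist_dist, dist_eq_norm]
  change ∑ i ∈ Finset.range m, edist (G (u (i + 1))) (G (u i)) ≤ _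
  rw [sum_eq]
  refine ENNReal.ofReal_le_ofReal ?_
  have hlim : Tendsto (fun n => ∑ i ∈ Finset.range m, l i (g n (u (i + 1)) - g n (u i))) atTop
      (𝓝 (∑ i ∈ Finset.range m, ‖G (u (i + 1)) - G (u i)‖)) := by
    refine tendsto_finsetSum _ fun i _ => ?_
    have hi : ‖G (u (i + 1)) - G (u i)‖ = l i (G (u (i + 1))) - l i (G (u i)) := by
      rw [← map_sub, hlG]; rfl
    simp only [hi, map_sub]
    exact (h _ (hus _) _).sub (h _ (hus _) _)
  refine le_of_tendsto hlim (Eventually.of_forall fun n => ?_)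
  have hn : ∑ i ∈ Finset.range m, ‖g n (u (i + 1)) - g n (u i)‖ ≤ C := by
    rw [← ENNReal.ofReal_le_ofReal_iff hC, ← sum_eq]
    exact (eVariationOn.sum_le hu hus).trans (hvar n)
  refine (Finset.sum_le_sum fun i _ => ?_).trans hn
  have := (l i).le_of_opNorm_le (hl i) (g n (u (i + 1)) - g n (u i))
  rw [one_mul] at this
  exact (le_abs_self _).trans this

/-- **Helly's selection principle** on the real line for maps into a reflexive space. -/
theorem exists_subseq_weak_limit_of_eVariationOn_le
    (hrefl : Function.Surjective ⇑(NormedSpace.inclusionInDoubleDual ℝ E))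
    {g : ℕ → ℝ → E} {C : ℝ} (hbdd : ∀ n t, ‖g n t‖ ≤ C)
    (hvar : ∀ n, eVariationOn (g n) Set.univ ≤ ENNReal.ofReal C) :
    ∃ φ : ℕ → ℕ, StrictMono φ ∧ ∃ G : ℝ → E, ∀ t, ∀ l : E →L[ℝ] ℝ,
      Tendsto (fun n => l (g (φ n) t)) atTop (𝓝 (l (G t))) := by
  have hC : 0 ≤ C := (norm_nonneg _).trans (hbdd 0 0)
  have hfin (n : ℕ) : eVariationOn (g n) Set.univ ≠ ⊤ :=
    ne_top_of_le_ne_top ENNReal.ofReal_ne_top (hvar n)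
  let V (n : ℕ) (t : ℝ) : ℝ := (eVariationOn (g n) (Set.Iic t)).toReal
  have hVle (n : ℕ) (t : ℝ) : |V n t| ≤ C := by
    rw [abs_of_nonneg ENNReal.toReal_nonneg]
    exact ENNReal.toReal_le_of_le_ofReal hC
      ((eVariationOn.mono _ (Set.subset_univ _)).trans (hvar n))
  have hVg (n : ℕ) {s t : ℝ} (hst : s ≤ t) : ‖g n t - g n s‖ ≤ V n t - V n s :=
    norm_sub_le_toReal_eVariationOn_sub (hfin n) hst
  have hVmono (n : ℕ) : Monotone (V n) := fun s t hst =>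
    sub_nonneg.mp ((norm_nonneg _).trans (hVg n hst))
  obtain ⟨φ, hφ, w, hw⟩ := exists_subseq_forall_tendsto (fun n (q : ℚ) => V n q)
    (fun _ => C) fun n q => hVle n q
  choose v hv using fun t => (hyperfilter ℕ).exists_tendsto_of_abs_le
    (fun n => V (φ n) t) C fun n => hVle (φ n) t
  have hvmono : Monotone v := fun s t hst =>
    le_of_tendsto_of_tendsto' (hv s) (hv t) fun n => hVmono (φ n) hst
  have hvw (q : ℚ) : Tendsto (fun n => V (φ n) q) atTop (𝓝 (v q)) := by
    rw [tendsto_nhds_unique (hv q) ((hw q).mono_left Nat.hyperfilter_le_atTop)]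
    exact hw q
  let T : Set ℝ := {t | ¬ ContinuousAt v t} ∪ Set.range ((↑) : ℚ → ℝ)
  have hT : T.Countable := hvmono.countable_not_continuousAt.union (Set.countable_range _)
  have := hT.to_subtype
  obtain ⟨ψ, hψ, hconv⟩ := exists_subseq_forall_weak_limit hrefl
    (x := fun n (t : T) => g (φ n) t) fun n t => hbdd (φ n) t
  refine ⟨φ ∘ ψ, hφ.comp hψ, ?_⟩
  suffices H : ∀ t, ∃ y : E, ∀ l : E →L[ℝ] ℝ,
      Tendsto (fun n => l (g ((φ ∘ ψ) n) t)) atTop (𝓝 (l y)) from Classical.skolem.mp H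
  intro t
  by_cases ht : t ∈ T
  · exact hconv ⟨t, ht⟩
  have hcont : ContinuousAt v t := by
    by_contra hc
    exact ht (Or.inl hc)
  refine exists_weak_limit_of_forall_tendsto hrefl (fun n => hbdd _ t) fun l =>
    cauchySeq_tendsto_of_complete (Metric.cauchySeq_iff'.mpr fun ε hε => ?_)
  obtain ⟨δ, hδ, hδε⟩ : ∃ δ > 0, (2 * ‖l‖ + 1) * δ < ε := by
    refine ⟨ε / (2 * ‖l‖ + 2), by positivity, ?_⟩
    rw [mul_div_assoc', div_lt_iff₀ (by positivity)]
    nlinarith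
  obtain ⟨η, hη, hvη⟩ := Metric.continuousAt_iff.mp hcont (δ / 2) (half_pos hδ)
  obtain ⟨p, hp1, hp2⟩ := exists_rat_btwn (sub_lt_self t hη)
  obtain ⟨q, hq1, hq2⟩ := exists_rat_btwn (lt_add_of_pos_right t hη)
  have hpq : v q - v p < δ := by
    have h1 := hvη (x := p) (by rw [Real.dist_eq, abs_lt]; constructor <;> linarith)
    have h2 := hvη (x := q) (by rw [Real.dist_eq, abs_lt]; constructor <;> linarith)
    rw [Real.dist_eq, abs_lt] at h1 h2
    linarith
  have hsmall : ∀ᶠ n in atTop, V (φ (ψ n)) q - V (φ (ψ n)) p < δ :=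
    hψ.tendsto_atTop.eventually (((hvw q).sub (hvw p)).eventually_lt_const hpq)
  obtain ⟨N₁, hN₁⟩ := eventually_atTop.mp hsmall
  obtain ⟨y, hy⟩ := hconv ⟨p, Or.inr ⟨p, rfl⟩⟩
  obtain ⟨N₂, hN₂⟩ := Metric.cauchySeq_iff.mp (hy l).cauchySeq δ hδ
  have hclose (n : ℕ) (hn : N₁ ≤ n) :
      |l (g (φ (ψ n)) t) - l (g (φ (ψ n)) p)| ≤ ‖l‖ * δ := by
    rw [← map_sub]
    refine abs_dual_apply_le ((hVg _ hp2.le).trans ?_) l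
    linarith [hVmono (φ (ψ n)) hq1.le, hN₁ n hn]
  refine ⟨max N₁ N₂, fun n hn => ?_⟩
  have h1 := abs_le.mp (hclose n ((le_max_left _ _).trans hn))
  have h2 := abs_le.mp (hclose _ (le_max_left N₁ N₂))
  have h3 := hN₂ n ((le_max_right _ _).trans hn) _ (le_max_right N₁ N₂)
  rw [Real.dist_eq, abs_lt] at h3 ⊢
  simp only [Function.comp_apply] at h3 ⊢
  constructor <;> linarith [h1.1, h1.2, h2.1, h2.2, h3.1, h3.2]

end Reflexive

/-- (Helly's Selection Principle in a reflexive Banach space.)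
A sequence of maps from `[0, τ]` into a reflexive Banach space `E` which is
uniformly bounded in norm and of uniformly bounded variation admits a subsequence
converging weakly, pointwise in time, to a map of bounded variation. -/
theorem statement_7 (E : Type*) [NormedAddCommGroup E] [NormedSpace ℝ E]
    [CompleteSpace E]
    (hrefl : Function.Surjective ⇑(NormedSpace.inclusionInDoubleDual ℝ E))
    (τ : ℝ) (hτ : 0 < τ) (S : ℕ → ℝ → E) (C : ℝ) (hC : 0 < C)
    (hbdd : ∀ N : ℕ, ∀ t ∈ Set.Icc (0:ℝ) τ, ‖S N t‖ ≤ C)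
    (hvar : ∀ N : ℕ, eVariationOn (S N) (Set.Icc 0 τ) ≤ ENNReal.ofReal C) :
    ∃ φ : ℕ → ℕ, StrictMono φ ∧
      ∃ Slim : ℝ → E,
        eVariationOn Slim (Set.Icc 0 τ) ≤ ENNReal.ofReal C ∧
        ∀ t ∈ Set.Icc (0:ℝ) τ, ∀ ℓ : E →L[ℝ] ℝ,
          Tendsto (fun i => ℓ (S (φ i) t)) atTop (𝓝 (ℓ (Slim t))) := by
  let p (t : ℝ) : ℝ := Set.projIcc 0 τ hτ.le t
  have hp (t : ℝ) : p t ∈ Set.Icc 0 τ := (Set.projIcc 0 τ hτ.le t).2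
  have hpmono : MonotoneOn p Set.univ := fun s _ t _ hst => Set.monotone_projIcc hτ.le hst
  have hgvar (n : ℕ) : eVariationOn (S n ∘ p) Set.univ ≤ ENNReal.ofReal C :=
    (eVariationOn.comp_le_of_monotoneOn (S n) p hpmono fun t _ => hp t).trans (hvar n)
  obtain ⟨φ, hφ, G, hG⟩ := exists_subseq_weak_limit_of_eVariationOn_le hrefl
    (g := fun n => S n ∘ p) (fun n t => hbdd n _ (hp t)) hgvar
  have hlim : ∀ t ∈ Set.Icc (0 : ℝ) τ, ∀ l : E →L[ℝ] ℝ,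
      Tendsto (fun i => l (S (φ i) t)) atTop (𝓝 (l (G t))) := fun t ht l => by
    simpa only [p, Function.comp_apply, Set.projIcc_of_mem hτ.le ht] using hG t l
  exact ⟨φ, hφ, G, eVariationOn_le_of_tendsto_weak hC.le (fun n => hvar (φ n)) hlim, hlim⟩
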